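/- arXiv:2509.00223 — 4 statements merged into one kernel-verified Lean document; each statement's English description precedes it below -/
import Mathlib

section
/- Let I be a 2×2 real symmetric positive definite matrix, Σ = I⁻¹, ρ = Σ₁₂/√(Σ₁₁Σ₂₂), p_SL = arccos(I₁₂/√(I₁₁I₂₂))/(2π) and p_KS = arccos(ρ)/(2π). Then p_KS = 1/2 − p_SL; consequently the ordered triple of mixture weights (1/2 − p_SL, 1/2, p_SL) of Self and Liang equals the triple (p_KS, 1/2, 1/2 − p_KS) of Kopylev and Sinha. -/
/-- The off-diagonal correlation coefficient of the inverse of a real `2 × 2` matrix with positive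
determinant is the negative of that of the matrix itself. -/
theorem Matrix.inv_fin_two_div_sqrt_eq_neg (A : Matrix (Fin 2) (Fin 2) ℝ) (hA : 0 < A.det) :
    A⁻¹ 0 1 / Real.sqrt (A⁻¹ 0 0 * A⁻¹ 1 1) = -(A 0 1 / Real.sqrt (A 0 0 * A 1 1)) := by
  have h00 : A⁻¹ 0 0 = A 1 1 / A.det := by
    simp [Matrix.inv_def, Matrix.adjugate_fin_two, div_eq_inv_mul]
  have h11 : A⁻¹ 1 1 = A 0 0 / A.det := by
    simp [Matrix.inv_def, Matrix.adjugate_fin_two, div_eq_inv_mul]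
  have h01 : A⁻¹ 0 1 = -A 0 1 / A.det := by
    simp [Matrix.inv_def, Matrix.adjugate_fin_two, div_eq_inv_mul]
  rw [h00, h11, h01, div_mul_div_comm, Real.sqrt_div' _ (mul_self_nonneg _),
    Real.sqrt_mul_self hA.le, div_div_div_cancel_right₀ hA.ne', mul_comm (A 1 1), neg_div]

/-- Equivalence of the Self–Liang and Kopylev–Sinha mixture weights for two
parameters of interest on the boundary. -/
theorem stmt_1 (I : Matrix (Fin 2) (Fin 2) ℝ) (hI : I.PosDef) :
    let S := I⁻¹
    let ρ := S 0 1 / Real.sqrt (S 0 0 * S 1 1)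
    let pSL := Real.arccos (I 0 1 / Real.sqrt (I 0 0 * I 1 1)) / (2 * Real.pi)
    let pKS := Real.arccos ρ / (2 * Real.pi)
    pKS = 1 / 2 - pSL ∧
      ((1 / 2 - pSL, 1 / 2, pSL) : ℝ × ℝ × ℝ) = ((pKS, 1 / 2, 1 / 2 - pKS) : ℝ × ℝ × ℝ) := by
  intro S ρ pSL pKS
  have h : pKS = 1 / 2 - pSL := by
    simp only [pKS, pSL, ρ, S]
    rw [Matrix.inv_fin_two_div_sqrt_eq_neg I hI.det_pos, Real.arccos_neg]
    field_simp
  exact ⟨h, by rw [h, sub_sub_cancel]⟩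
end

section
/- (Region 6, ρ ≥ 0.) For ρ ∈ [0, 1), let v, u, C₀, C₁ be as defined. If z = (z₁, z₂) ∈ ℝ² satisfies z₁ ≥ 0 and z₂ ≤ 0, then dist(z, C₀)² = ‖z‖² = z₁² + z₂² and dist(z, C₁)² = z₂², so dist(z, C₀)² − dist(z, C₁)² = z₁² (the second χ²₁ region of the likelihood ratio statistic). -/
/-- The null cone direction `v = (−ρ, √(1−ρ²))`. -/
noncomputable def vRho (ρ : ℝ) : EuclideanSpace ℝ (Fin 2) :=
  (WithLp.equiv 2 (Fin 2 → ℝ)).symm ![-ρ, Real.sqrt (1 - ρ ^ 2)]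

/-- The orthogonal direction `u = (√(1−ρ²), ρ)`. -/
noncomputable def uRho (ρ : ℝ) : EuclideanSpace ℝ (Fin 2) :=
  (WithLp.equiv 2 (Fin 2 → ℝ)).symm ![Real.sqrt (1 - ρ ^ 2), ρ]

/-- The first standard basis vector `(1, 0)`. -/
noncomputable def eOne : EuclideanSpace ℝ (Fin 2) :=
  (WithLp.equiv 2 (Fin 2 → ℝ)).symm ![1, 0]

/-- The null cone `C₀ = {t•v : t ≥ 0}`. -/
def C0 (ρ : ℝ) : Set (EuclideanSpace ℝ (Fin 2)) :=
  {w | ∃ t : ℝ, 0 ≤ t ∧ w = t • vRho ρ}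

/-- The alternative cone `C₁ = {a•(1,0) + b•v : a ≥ 0, b ≥ 0}`. -/
def C1 (ρ : ℝ) : Set (EuclideanSpace ℝ (Fin 2)) :=
  {w | ∃ a b : ℝ, 0 ≤ a ∧ 0 ≤ b ∧ w = a • eOne + b • vRho ρ}

theorem infDist_eq_dist_of_forall_le {X : Type*} [PseudoMetricSpace X] {s : Set X} {x y : X}
    (hy : y ∈ s) (h : ∀ w ∈ s, dist x y ≤ dist x w) : Metric.infDist x s = dist x y :=
  le_antisymm (Metric.infDist_le_dist_of_mem hy) ((Metric.le_infDist ⟨y, hy⟩).2 fun _ hw => h _ hw)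

theorem dist_eq_sqrt_fin_two (x y : EuclideanSpace ℝ (Fin 2)) :
    dist x y = √((x 0 - y 0) ^ 2 + (x 1 - y 1) ^ 2) := by
  simp [EuclideanSpace.dist_eq, Real.dist_eq, sq_abs]

/-- Region 6 (`ρ ≥ 0`): if `z₁ ≥ 0` and `z₂ ≤ 0` then `dist(z,C₀)² = ‖z‖² = z₁² + z₂²`
and `dist(z,C₁)² = z₂²`, so the likelihood ratio statistic equals `z₁²` (χ²₁). -/
theorem stmt_11 (ρ : ℝ) (hρ : ρ ∈ Set.Ico (0 : ℝ) 1)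
    (z : EuclideanSpace ℝ (Fin 2)) (hz1 : 0 ≤ z 0) (hz2 : z 1 ≤ 0) :
    Metric.infDist z (C0 ρ) ^ 2 = ‖z‖ ^ 2 ∧
    ‖z‖ ^ 2 = z 0 ^ 2 + z 1 ^ 2 ∧
    Metric.infDist z (C1 ρ) ^ 2 = z 1 ^ 2 ∧
    Metric.infDist z (C0 ρ) ^ 2 - Metric.infDist z (C1 ρ) ^ 2 = z 0 ^ 2 := by
  obtain ⟨hρ0, -⟩ := hρ
  have hs : 0 ≤ √(1 - ρ ^ 2) := Real.sqrt_nonneg _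
  have hnorm : ‖z‖ ^ 2 = z 0 ^ 2 + z 1 ^ 2 := by
    simp [EuclideanSpace.norm_sq_eq, sq_abs]
  have h0 : Metric.infDist z (C0 ρ) ^ 2 = ‖z‖ ^ 2 := by
    rw [infDist_eq_dist_of_forall_le (s := C0 ρ) (x := z) (y := 0) ⟨0, le_rfl, by simp⟩, dist_zero_right]
    rintro _ ⟨t, ht, rfl⟩
    rw [dist_eq_sqrt_fin_two, dist_eq_sqrt_fin_two]
    apply Real.sqrt_le_sqrt
    simp only [vRho, PiLp.zero_apply, PiLp.smul_apply, WithLp.equiv_symm_apply, smul_eq_mul,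
      Matrix.cons_val_zero, Matrix.cons_val_one]
    have h1 := mul_nonneg (mul_nonneg ht hρ0) hz1
    have h2 := mul_nonneg (mul_nonneg ht hs) (neg_nonneg.2 hz2)
    nlinarith [sq_nonneg (t * ρ), sq_nonneg (t * √(1 - ρ ^ 2))]
  have h1 : Metric.infDist z (C1 ρ) ^ 2 = z 1 ^ 2 := by
    rw [infDist_eq_dist_of_forall_le (s := C1 ρ) (x := z) (y := z 0 • eOne)
        ⟨z 0, 0, hz1, le_rfl, by simp⟩,
      dist_eq_sqrt_fin_two, Real.sq_sqrt (by positivity)]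
    · simp [eOne]
    rintro _ ⟨a, b, -, hb, rfl⟩
    rw [dist_eq_sqrt_fin_two, dist_eq_sqrt_fin_two]
    apply Real.sqrt_le_sqrt
    simp only [vRho, eOne, PiLp.add_apply, PiLp.smul_apply, WithLp.equiv_symm_apply, smul_eq_mul,
      Matrix.cons_val_zero, Matrix.cons_val_one]
    have h2 := mul_nonneg (mul_nonneg hb hs) (neg_nonneg.2 hz2)
    nlinarith [sq_nonneg (z 0 - (a * 1 + b * -ρ)), sq_nonneg (b * √(1 - ρ ^ 2))]
  exact ⟨h0, hnorm, h1, by rw [h0, h1, hnorm]; ring⟩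
end

section
/- (Weight of the χ²₂ component.) Let γ₂ denote the standard bivariate Gaussian probability measure on ℝ². For every ρ ∈ [0, 1], the γ₂-measure of the set {(z₁, z₂) ∈ ℝ² : z₁ > 0, z₂ > 0, √(1−ρ²)·z₂ < ρ·z₁} (Region 1) equals arcsin(ρ)/(2π). -/
open MeasureTheory ProbabilityTheory Set in
/-- The standard bivariate Gaussian measure in polar coordinates: a constant multiple (given by the
radial integral) of the angular measure. -/
theorem gaussianReal_prod_apply_of_polar {S : Set (ℝ × ℝ)} (hS : MeasurableSet S) {A : Set ℝ}
    (hA : MeasurableSet A) (hsub : A ⊆ Ioo (-Real.pi) Real.pi)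
    (h : ∀ r > 0, ∀ θ ∈ Ioo (-Real.pi) Real.pi, (r * Real.cos θ, r * Real.sin θ) ∈ S ↔ θ ∈ A) :
    ((gaussianReal 0 1).prod (gaussianReal 0 1)) S =
      (∫⁻ r in Ioi (0 : ℝ), ENNReal.ofReal r * (gaussianPDF 0 1 r * gaussianPDF 0 1 0)) *
        volume A := by
  have hpdf (r θ : ℝ) : gaussianPDF 0 1 (r * Real.cos θ) * gaussianPDF 0 1 (r * Real.sin θ) =
      gaussianPDF 0 1 r * gaussianPDF 0 1 0 := by
    simp only [gaussianPDF]
    rw [← ENNReal.ofReal_mul (gaussianPDFReal_nonneg _ _ _),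
      ← ENNReal.ofReal_mul (gaussianPDFReal_nonneg _ _ _)]
    simp only [gaussianPDFReal]
    simp only [mul_mul_mul_comm _ (Real.exp _) _ (Real.exp _), ← Real.exp_add]
    congr 3
    have := Real.sin_sq_add_cos_sq θ
    simp only [NNReal.coe_one]
    linear_combination (-r ^ 2 / 2) * this
  have hcone (p : ℝ × ℝ) (hp : p ∈ polarCoord.target) :
      ENNReal.ofReal p.1 • S.indicator (fun z ↦ gaussianPDF 0 1 z.1 * gaussianPDF 0 1 z.2)
        (polarCoord.symm p) =
      ENNReal.ofReal p.1 * (gaussianPDF 0 1 p.1 * gaussianPDF 0 1 0) * A.indicator 1 p.2 := by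
    have hmem := h p.1 hp.1 p.2 hp.2
    by_cases hpA : p.2 ∈ A
    · simp [hmem.2 hpA, hpA, hpdf]
    · simp [mt hmem.1 hpA, hpA]
  rw [gaussianReal_of_var_ne_zero 0 one_ne_zero,
    prod_withDensity (measurable_gaussianPDF 0 1) (measurable_gaussianPDF 0 1),
    withDensity_apply _ hS, ← lintegral_indicator hS, ← Measure.volume_eq_prod,
    ← lintegral_comp_polarCoord_symm,
    setLIntegral_congr_fun polarCoord.open_target.measurableSet hcone, polarCoord_target,
    Measure.volume_eq_prod, ← Measure.prod_restrict,
    lintegral_prod_mul (f := fun r ↦ ENNReal.ofReal r * (gaussianPDF 0 1 r * gaussianPDF 0 1 0))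
      (by fun_prop) (measurable_one.indicator hA).aemeasurable, lintegral_indicator_one hA,
    Measure.restrict_apply hA, inter_eq_left.2 hsub]

open MeasureTheory ProbabilityTheory Set in
/-- The standard bivariate Gaussian measure of a cone is its normalized angle. -/
theorem gaussianReal_prod_cone {S : Set (ℝ × ℝ)} (hS : MeasurableSet S) {A : Set ℝ}
    (hA : MeasurableSet A) (hsub : A ⊆ Ioo (-Real.pi) Real.pi)
    (h : ∀ r > 0, ∀ θ ∈ Ioo (-Real.pi) Real.pi, (r * Real.cos θ, r * Real.sin θ) ∈ S ↔ θ ∈ A) :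
    ((gaussianReal 0 1).prod (gaussianReal 0 1)) S =
      volume A / ENNReal.ofReal (2 * Real.pi) := by
  have huniv := gaussianReal_prod_apply_of_polar MeasurableSet.univ measurableSet_Ioo subset_rfl
    (fun r _ θ hθ ↦ iff_of_true (mem_univ _) hθ)
  rw [measure_univ, Real.volume_Ioo, sub_neg_eq_add, ← two_mul] at huniv
  rw [gaussianReal_prod_apply_of_polar hS hA hsub h,
    ENNReal.eq_inv_of_mul_eq_one_left huniv.symm, mul_comm, div_eq_mul_inv]

/-- Weight of the χ²₂ component: for `ρ ∈ [0,1]`, the standard bivariate Gaussian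
measure of Region 1, `{(z₁,z₂) : z₁ > 0, z₂ > 0, √(1−ρ²) z₂ < ρ z₁}`,
equals `arcsin(ρ)/(2π)`. -/
theorem stmt_16 (ρ : ℝ) (hρ : ρ ∈ Set.Icc (0 : ℝ) 1) :
    ((ProbabilityTheory.gaussianReal 0 1).prod (ProbabilityTheory.gaussianReal 0 1))
      {p : ℝ × ℝ | 0 < p.1 ∧ 0 < p.2 ∧ Real.sqrt (1 - ρ ^ 2) * p.2 < ρ * p.1}
      = ENNReal.ofReal (Real.arcsin ρ / (2 * Real.pi)) := by
  have hpi := Real.pi_pos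
  have hα := Real.arcsin_le_pi_div_two ρ
  have hα₀ := Real.arcsin_nonneg.2 hρ.1
  have hS : MeasurableSet
      {p : ℝ × ℝ | 0 < p.1 ∧ 0 < p.2 ∧ Real.sqrt (1 - ρ ^ 2) * p.2 < ρ * p.1} := by
    simp only [Set.ofPred_and]
    exact (measurableSet_lt (by fun_prop) (by fun_prop)).inter
      ((measurableSet_lt (by fun_prop) (by fun_prop)).inter
        (measurableSet_lt (by fun_prop) (by fun_prop)))
  rw [gaussianReal_prod_cone hS (A := Set.Ioo 0 (Real.arcsin ρ)) measurableSet_Ioo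
    (Set.Ioo_subset_Ioo (by linarith) (by linarith)), Real.volume_Ioo, sub_zero,
    ENNReal.ofReal_div_of_pos (by positivity)]
  intro r hr θ hθ
  have hsin : Real.sin (Real.arcsin ρ - θ) =
      ρ * Real.cos θ - Real.sqrt (1 - ρ ^ 2) * Real.sin θ := by
    rw [Real.sin_sub, Real.sin_arcsin (by linarith [hρ.1]) hρ.2, Real.cos_arcsin]
  have hlt : Real.sqrt (1 - ρ ^ 2) * (r * Real.sin θ) < ρ * (r * Real.cos θ) ↔
      0 < Real.sin (Real.arcsin ρ - θ) := by
    rw [hsin, sub_pos, mul_left_comm, mul_left_comm ρ, mul_lt_mul_iff_right₀ hr]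
  simp only [Set.mem_ofPred_eq, hlt, mul_pos_iff_of_pos_left hr, Set.mem_Ioo]
  constructor
  · rintro ⟨-, hs, hd⟩
    have hθ₀ : 0 < θ := by
      by_contra! hle
      exact hs.not_ge (Real.sin_nonpos_of_nonpos_of_neg_pi_le hle hθ.1.le)
    refine ⟨hθ₀, ?_⟩
    by_contra! hle
    exact hd.not_ge (Real.sin_nonpos_of_nonpos_of_neg_pi_le (by linarith) (by linarith [hθ.2]))
  · rintro ⟨hθ₀, hθα⟩
    exact ⟨Real.cos_pos_of_mem_Ioo ⟨by linarith, by linarith⟩,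
      Real.sin_pos_of_pos_of_lt_pi hθ₀ hθ.2,
      Real.sin_pos_of_pos_of_lt_pi (by linarith) (by linarith)⟩
end

section
/- (Case 7 χ²₂ weight.) Let γ₂ denote the standard bivariate Gaussian probability measure on ℝ², let M be an invertible 2×2 real matrix, and let C̃ = M(Q⁺) = {M x : x ∈ ℝ², x₁ ≥ 0, x₂ ≥ 0} be the image of the closed positive quadrant under M. Then γ₂(C̃) = arccos( (MᵀM)₁₂ / √((MᵀM)₁₁ · (MᵀM)₂₂) ) / (2π). In particular, if MᵀM = I is the Fisher information matrix, the probability that the standard Gaussian score vector falls in the transformed alternative cone is arccos(I₁₂/√(I₁₁I₂₂))/(2π). -/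
open Matrix

open MeasureTheory ProbabilityTheory Set Filter Topology

theorem lintegral_Ioi_of_hasDerivAt_of_nonneg {g g' : ℝ → ℝ} {a l : ℝ}
    (hderiv : ∀ x ∈ Ici a, HasDerivAt g (g' x) x) (hnonneg : ∀ x ∈ Ioi a, 0 ≤ g' x)
    (hlim : Tendsto g atTop (𝓝 l)) :
    ∫⁻ x in Ioi a, ENNReal.ofReal (g' x) = ENNReal.ofReal (l - g a) := by
  rw [← integral_Ioi_of_hasDerivAt_of_nonneg' hderiv hnonneg hlim,
    ofReal_integral_eq_lintegral_ofReal (integrableOn_Ioi_deriv_of_nonneg' hderiv hnonneg hlim)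
      ((ae_restrict_iff' measurableSet_Ioi).2 (ae_of_all _ hnonneg))]

theorem lintegral_Ioi_mul_exp_neg_mul_sq_div_two {q : ℝ} (hq : 0 < q) :
    ∫⁻ x in Ioi (0 : ℝ), ENNReal.ofReal (x * Real.exp (-(q * x ^ 2) / 2))
      = ENNReal.ofReal (1 / q) := by
  have hderiv (x : ℝ) : HasDerivAt (fun x : ℝ ↦ -(1 / q) * Real.exp (-(q * x ^ 2) / 2))
      (x * Real.exp (-(q * x ^ 2) / 2)) x := by
    refine ((((((hasDerivAt_pow 2 x).const_mul q).neg).div_const 2).exp).const_mul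
      (-(1 / q))).congr_deriv ?_
    simp only [Pi.neg_apply]
    field_simp
    norm_num [mul_comm]
  rw [lintegral_Ioi_of_hasDerivAt_of_nonneg (l := 0) (fun x _ ↦ hderiv x)
    (fun x hx ↦ mul_nonneg (le_of_lt hx) (Real.exp_pos _).le)]
  · simp
  · rw [show (0 : ℝ) = -(1 / q) * 0 by simp]
    refine (Real.tendsto_exp_atBot.comp ?_).const_mul _
    refine Tendsto.atBot_div_const two_pos (tendsto_neg_atTop_atBot.comp ?_)
    exact (tendsto_pow_atTop two_ne_zero).const_mul_atTop hq

theorem quadratic_pos {a b c D : ℝ} (hc : 0 < c) (hD : 0 < D)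
    (hdisc : D ^ 2 = a * c - b ^ 2) (t : ℝ) : 0 < a + 2 * b * t + c * t ^ 2 := by
  refine pos_of_mul_pos_right (b := a + 2 * b * t + c * t ^ 2) ?_ hc.le
  nlinarith [sq_nonneg (b + c * t), pow_pos hD 2]

theorem lintegral_Ioi_inv_quadratic {a b c D : ℝ} (hc : 0 < c) (hD : 0 < D)
    (hdisc : D ^ 2 = a * c - b ^ 2) :
    ∫⁻ t in Ioi (0 : ℝ), ENNReal.ofReal (1 / (a + 2 * b * t + c * t ^ 2))
      = ENNReal.ofReal ((Real.pi / 2 - Real.arctan (b / D)) / D) := by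
  have hq := quadratic_pos hc hD hdisc
  have hderiv (t : ℝ) : HasDerivAt (fun t : ℝ ↦ Real.arctan ((b + c * t) / D) / D)
      (1 / (a + 2 * b * t + c * t ^ 2)) t := by
    refine ((((((hasDerivAt_id t).const_mul c).const_add b).div_const D).arctan).div_const
      D).congr_deriv ?_
    have h1 : D ^ 2 + (b + c * t) ^ 2 = c * (a + 2 * b * t + c * t ^ 2) := by rw [hdisc]; ring
    have h2 : 1 + ((b + c * t) / D) ^ 2 = c * (a + 2 * b * t + c * t ^ 2) / D ^ 2 := by
      rw [← h1]; field_simp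
    have := (hq t).ne'
    simp only [id, h2]
    field_simp
  rw [lintegral_Ioi_of_hasDerivAt_of_nonneg (l := Real.pi / 2 / D) (fun x _ ↦ hderiv x)
    (fun x _ ↦ (one_div_pos.2 (hq x)).le)]
  · simp [sub_div]
  · refine ((Real.tendsto_arctan_atTop.mono_right nhdsWithin_le_nhds).comp ?_).div_const D
    exact (tendsto_atTop_add_const_left _ b (tendsto_id.const_mul_atTop hc)).atTop_div_const hD

theorem setLIntegral_Ioi_comp_mul_left {x : ℝ} (hx : 0 < x) (f : ℝ → ENNReal) :
    ∫⁻ y in Ioi (0 : ℝ), f y = ∫⁻ t in Ioi (0 : ℝ), ENNReal.ofReal x * f (x * t) := by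
  have himage : (fun t ↦ x * t) '' Ioi 0 = Ioi 0 := by
    simpa using Set.image_mul_left_Ioi hx 0
  conv_lhs => rw [← himage]
  rw [lintegral_image_eq_lintegral_abs_deriv_mul (f' := fun _ ↦ x) measurableSet_Ioi
    (fun t _ ↦ by simpa using ((hasDerivAt_id t).const_mul x).hasDerivWithinAt)
    (mul_right_injective₀ hx.ne').injOn, abs_of_pos hx]

theorem lintegral_quadrant_exp_neg_quadratic {a b c D : ℝ} (hc : 0 < c) (hD : 0 < D)
    (hdisc : D ^ 2 = a * c - b ^ 2) :
    ∫⁻ p in Ici (0 : ℝ) ×ˢ Ici (0 : ℝ),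
        ENNReal.ofReal (Real.exp (-(a * p.1 ^ 2 + 2 * b * p.1 * p.2 + c * p.2 ^ 2) / 2))
      = ENNReal.ofReal ((Real.pi / 2 - Real.arctan (b / D)) / D) := by
  have hq := quadratic_pos hc hD hdisc
  rw [Measure.volume_eq_prod, setLIntegral_prod _ (by fun_prop)]
  simp_rw [← restrict_Ioi_eq_restrict_Ici]
  calc
    _ = ∫⁻ x in Ioi (0 : ℝ), ∫⁻ t in Ioi (0 : ℝ),
          ENNReal.ofReal (x * Real.exp (-((a + 2 * b * t + c * t ^ 2) * x ^ 2) / 2)) := by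
      refine setLIntegral_congr_fun measurableSet_Ioi fun x (hx : 0 < x) ↦ ?_
      rw [setLIntegral_Ioi_comp_mul_left hx]
      refine lintegral_congr fun t ↦ ?_
      rw [← ENNReal.ofReal_mul hx.le]
      ring_nf
    _ = ∫⁻ t in Ioi (0 : ℝ), ∫⁻ x in Ioi (0 : ℝ),
          ENNReal.ofReal (x * Real.exp (-((a + 2 * b * t + c * t ^ 2) * x ^ 2) / 2)) :=
      lintegral_lintegral_swap (by unfold Function.uncurry; fun_prop)
    _ = ∫⁻ t in Ioi (0 : ℝ), ENNReal.ofReal (1 / (a + 2 * b * t + c * t ^ 2)) :=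
      lintegral_congr fun t ↦ lintegral_Ioi_mul_exp_neg_mul_sq_div_two (hq t)
    _ = _ := lintegral_Ioi_inv_quadratic hc hD hdisc

theorem gaussianReal_prod_apply {s : Set (ℝ × ℝ)} (hs : MeasurableSet s) :
    ((gaussianReal 0 1).prod (gaussianReal 0 1)) s
      = ∫⁻ p in s, ENNReal.ofReal (Real.exp (-(p.1 ^ 2 + p.2 ^ 2) / 2) / (2 * Real.pi)) := by
  rw [gaussianReal_of_var_ne_zero 0 one_ne_zero,
    prod_withDensity (measurable_gaussianPDF 0 1) (measurable_gaussianPDF 0 1),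
    withDensity_apply _ hs, Measure.volume_eq_prod]
  refine lintegral_congr fun p ↦ ?_
  rw [gaussianPDF, gaussianPDF, ← ENNReal.ofReal_mul (gaussianPDFReal_nonneg _ _ _)]
  congr 1
  have hsq : √(2 * Real.pi) * √(2 * Real.pi) = 2 * Real.pi := Real.mul_self_sqrt (by positivity)
  simp only [gaussianPDFReal, NNReal.coe_one, mul_one, sub_zero]
  rw [mul_mul_mul_comm, ← mul_inv, hsq, ← Real.exp_add]
  ring_nf

theorem toLin_finTwoProd_injective {M : Matrix (Fin 2) (Fin 2) ℝ} (hM : IsUnit M.det) :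
    Function.Injective
      (Matrix.toLin (Module.Basis.finTwoProd ℝ) (Module.Basis.finTwoProd ℝ) M) :=
  (LinearMap.equivOfDetNeZero (Matrix.toLin (Module.Basis.finTwoProd ℝ)
    (Module.Basis.finTwoProd ℝ) M) ((LinearMap.det_toLin _ M).trans_ne hM.ne_zero)).injective

theorem setLIntegral_image_toLin_finTwoProd (M : Matrix (Fin 2) (Fin 2) ℝ) (hM : IsUnit M.det)
    {s : Set (ℝ × ℝ)} (hs : MeasurableSet s) (g : ℝ × ℝ → ENNReal) :
    ∫⁻ p in Matrix.toLin (Module.Basis.finTwoProd ℝ) (Module.Basis.finTwoProd ℝ) M '' s, g p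
      = ∫⁻ p in s, ENNReal.ofReal |M.det| *
          g (Matrix.toLin (Module.Basis.finTwoProd ℝ) (Module.Basis.finTwoProd ℝ) M p) := by
  set L := Matrix.toLin (Module.Basis.finTwoProd ℝ) (Module.Basis.finTwoProd ℝ) M
  have hdet : LinearMap.det L = M.det := LinearMap.det_toLin _ M
  have h := lintegral_image_eq_lintegral_abs_det_fderiv_mul volume hs
    (f := L) (f' := fun _ ↦ LinearMap.toContinuousLinearMap L)
    (fun x _ ↦ (LinearMap.toContinuousLinearMap L).hasFDerivWithinAt) (toLin_finTwoProd_injective hM).injOn g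
  simpa only [LinearMap.det_toContinuousLinearMap, hdet] using h

theorem arccos_div_sqrt_eq_pi_div_two_sub_arctan {a b c D : ℝ} (hD : 0 < D)
    (hdisc : D ^ 2 = a * c - b ^ 2) :
    Real.arccos (b / √(a * c)) = Real.pi / 2 - Real.arctan (b / D) := by
  have h : 1 + (b / D) ^ 2 = a * c / D ^ 2 := by
    rw [show a * c = D ^ 2 + b ^ 2 by linarith]; field_simp
  rw [Real.arccos, Real.arctan_eq_arcsin, h, Real.sqrt_div' _ (sq_nonneg D), Real.sqrt_sq hD.le,
    div_div_div_cancel_right₀ hD.ne']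

/-- Case 7 χ²₂ weight: for an invertible 2×2 matrix `M`, the standard bivariate
Gaussian measure of the image `M(Q⁺)` of the closed positive quadrant equals
`arccos((MᵀM)₁₂ / √((MᵀM)₁₁ (MᵀM)₂₂)) / (2π)`. -/
theorem stmt_18 (M : Matrix (Fin 2) (Fin 2) ℝ) (hM : IsUnit M.det) :
    ((ProbabilityTheory.gaussianReal 0 1).prod (ProbabilityTheory.gaussianReal 0 1))
      {p : ℝ × ℝ | ∃ x : Fin 2 → ℝ, 0 ≤ x 0 ∧ 0 ≤ x 1 ∧ M.mulVec x = ![p.1, p.2]}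
      = ENNReal.ofReal (Real.arccos ((Mᵀ * M) 0 1 /
          Real.sqrt ((Mᵀ * M) 0 0 * (Mᵀ * M) 1 1)) / (2 * Real.pi)) := by
  have hL (p : ℝ × ℝ) :
      Matrix.toLin (Module.Basis.finTwoProd ℝ) (Module.Basis.finTwoProd ℝ) M p
        = (M 0 0 * p.1 + M 0 1 * p.2, M 1 0 * p.1 + M 1 1 * p.2) := by
    conv_lhs => rw [Matrix.eta_fin_two M]
    exact Matrix.toLin_finTwoProd_apply _ _ _ _ p
  have hset : {p : ℝ × ℝ | ∃ x : Fin 2 → ℝ, 0 ≤ x 0 ∧ 0 ≤ x 1 ∧ M.mulVec x = ![p.1, p.2]}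
      = Matrix.toLin (Module.Basis.finTwoProd ℝ) (Module.Basis.finTwoProd ℝ) M ''
          (Ici 0 ×ˢ Ici 0) := by
    ext p
    simp only [mem_ofPred_eq, mem_image, mem_prod, mem_Ici, hL, funext_iff, Fin.forall_fin_two,
      Prod.ext_iff, Matrix.mulVec, dotProduct, Fin.sum_univ_two, Matrix.cons_val_zero,
      Matrix.cons_val_one]
    constructor
    · rintro ⟨x, h0, h1, h⟩
      exact ⟨(x 0, x 1), ⟨h0, h1⟩, h⟩
    · rintro ⟨x, ⟨h0, h1⟩, h⟩
      exact ⟨![x.1, x.2], h0, h1, by simpa using h⟩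
  have hmeas : MeasurableSet {p : ℝ × ℝ | ∃ x : Fin 2 → ℝ,
      0 ≤ x 0 ∧ 0 ≤ x 1 ∧ M.mulVec x = ![p.1, p.2]} := by
    rw [hset]
    exact (measurableSet_Ici.prod measurableSet_Ici).image_of_continuousOn_injOn
      (LinearMap.continuous_of_finiteDimensional _).continuousOn
      (toLin_finTwoProd_injective hM).injOn
  have hD : 0 < |M.det| := abs_pos.2 hM.ne_zero
  have hdisc : |M.det| ^ 2 = (Mᵀ * M) 0 0 * (Mᵀ * M) 1 1 - (Mᵀ * M) 0 1 ^ 2 := by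
    simp only [sq_abs, Matrix.det_fin_two, Matrix.mul_apply, Matrix.transpose_apply,
      Fin.sum_univ_two]
    ring
  have hc : 0 < (Mᵀ * M) 1 1 := by
    have hnonneg : 0 ≤ (Mᵀ * M) 1 1 := by
      simp only [Matrix.mul_apply, Matrix.transpose_apply, Fin.sum_univ_two]
      nlinarith [mul_self_nonneg (M 0 1), mul_self_nonneg (M 1 1)]
    refine hnonneg.lt_of_ne fun h ↦ ?_
    rw [← h] at hdisc
    nlinarith [pow_pos hD 2, sq_nonneg ((Mᵀ * M) 0 1)]
  rw [gaussianReal_prod_apply hmeas, hset,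
    setLIntegral_image_toLin_finTwoProd M hM (measurableSet_Ici.prod measurableSet_Ici),
    arccos_div_sqrt_eq_pi_div_two_sub_arctan hD hdisc]
  calc
    _ = ∫⁻ p in Ici (0 : ℝ) ×ˢ Ici (0 : ℝ), ENNReal.ofReal (|M.det| / (2 * Real.pi)) *
          ENNReal.ofReal (Real.exp (-((Mᵀ * M) 0 0 * p.1 ^ 2 + 2 * (Mᵀ * M) 0 1 * p.1 * p.2
            + (Mᵀ * M) 1 1 * p.2 ^ 2) / 2)) := by
      refine lintegral_congr fun p ↦ ?_
      rw [← ENNReal.ofReal_mul hD.le, ← ENNReal.ofReal_mul (by positivity), hL,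
        div_mul_eq_mul_div, mul_div_assoc]
      simp only [Matrix.mul_apply, Matrix.transpose_apply, Fin.sum_univ_two]
      ring_nf
    _ = _ := by
      rw [lintegral_const_mul' _ _ ENNReal.ofReal_ne_top,
        lintegral_quadrant_exp_neg_quadratic hc hD hdisc, ← ENNReal.ofReal_mul (by positivity)]
      congr 1
      field_simp
end
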